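/- Let p be an odd prime and G a finite p-group. Suppose H is a non-normal subgroup of G of order p and K is a normal subgroup of G such that G is the internal semidirect product H ⋉ K (i.e., K ⊴ G, H ∩ K = {1} and HK = G), every subgroup of K of order p is normal in G, and K is isomorphic to the quotient G/L for every normal subgroup L of G of order p. Then K is a cyclic group. -/

import Mathlib

/-- `S` is a normalized right transversal (NRT) of `H` in `G`: `1 ∈ S` and every `g ∈ G`
is uniquely `h * s` with `h ∈ H`, `s ∈ S`. -/
def IsNRT {G : Type*} [Group G] (H : Subgroup G) (S : Set G) : Prop :=
  (1 : G) ∈ S ∧ ∀ g : G, ∃! s, s ∈ S ∧ ∃ h ∈ H, g = h * s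

/-- `φ` is an isomorphism of NRTs from `S₁` (an NRT of `H₁`) onto `S₂` (an NRT of `H₂`):
it is a bijection from `S₁` to `S₂` carrying the induced operation of `S₁` to that of `S₂`,
where `z = x ∘ y` in `S` means `z ∈ S` and `x * y ∈ H * z`. -/
def IsNRTIso {G : Type*} [Group G] (H₁ H₂ : Subgroup G) (S₁ S₂ : Set G) (φ : G → G) : Prop :=
  Set.BijOn φ S₁ S₂ ∧
    ∀ x ∈ S₁, ∀ y ∈ S₁, ∀ z ∈ S₁, (∃ h ∈ H₁, x * y = h * z) →
      ∃ h ∈ H₂, φ x * φ y = h * φ z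

/-- Two subgroups are adjacent in the transiso graph if they admit isomorphic NRTs. -/
def TransisoAdj {G : Type*} [Group G] (H₁ H₂ : Subgroup G) : Prop :=
  ∃ S₁ S₂ : Set G, IsNRT H₁ S₁ ∧ IsNRT H₂ S₂ ∧ ∃ φ : G → G, IsNRTIso H₁ H₂ S₁ S₂ φ

/-- The transiso graph `Γ_d(G)` is complete: any two distinct subgroups of order `d`
are adjacent. -/
def TransisoComplete (G : Type*) [Group G] (d : ℕ) : Prop :=
  ∀ H₁ H₂ : Subgroup G, Nat.card H₁ = d → Nat.card H₂ = d → H₁ ≠ H₂ →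
    TransisoAdj H₁ H₂

/-- A nontrivial subgroup of a finite `p`-group contains a subgroup of order `p`. -/
theorem IsPGroup.exists_le_card_eq {G : Type*} [Group G] [Finite G] {p : ℕ} (hp : p.Prime)
    (hG : IsPGroup p G) {A : Subgroup G} (hA : A ≠ ⊥) : ∃ L ≤ A, Nat.card L = p := by
  have := Fact.mk hp
  have hdvd : p ∣ Nat.card A := by
    obtain ⟨n, hn⟩ := IsPGroup.iff_card.mp (hG.to_subgroup A)
    rcases Nat.eq_zero_or_pos n with rfl | hpos
    · exact absurd (Subgroup.card_eq_one.mp (by simpa using hn)) hA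
    · exact hn ▸ dvd_pow_self p hpos.ne'
  obtain ⟨a, ha⟩ := exists_prime_orderOf_dvd_card' p hdvd
  refine ⟨Subgroup.zpowers (a : G), by simp, ?_⟩
  rw [Nat.card_zpowers, Subgroup.orderOf_coe, ha]

/-- The image of `H` under a homomorphism whose kernel meets `H` trivially has the same order. -/
theorem Subgroup.card_map_of_inf_ker_eq_bot {G G' : Type*} [Group G] [Group G'] {H : Subgroup G}
    {f : G →* G'} (h : H ⊓ f.ker = ⊥) : Nat.card (H.map f) = Nat.card H := by
  have hinj : Function.Injective (f.comp H.subtype) := by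
    rw [injective_iff_map_eq_one]
    intro x hx
    have hmem : (x : G) ∈ H ⊓ f.ker := ⟨x.2, hx⟩
    rw [h, Subgroup.mem_bot] at hmem
    exact Subtype.ext hmem
  have hrange : (f.comp H.subtype).range = H.map f := by
    rw [MonoidHom.range_comp, Subgroup.range_subtype]
  rw [← hrange]
  exact (Nat.card_congr (MonoidHom.ofInjective hinj).toEquiv).symm

/-- If two subgroups `L₁`, `L₂` of `K` intersect trivially and `H` is a complement of `K`,
then `H L₁ ∩ H L₂ = H`. -/
theorem Subgroup.sup_inf_sup_eq_of_inf_eq_bot {G : Type*} [Group G] {H K L₁ L₂ : Subgroup G}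
    [L₁.Normal] [L₂.Normal] (h₁ : L₁ ≤ K) (h₂ : L₂ ≤ K) (hHK : H ⊓ K = ⊥) (hL : L₁ ⊓ L₂ = ⊥) :
    (H ⊔ L₁) ⊓ (H ⊔ L₂) = H := by
  refine le_antisymm ?_ (le_inf le_sup_left le_sup_left)
  rintro g ⟨hg₁, hg₂⟩
  obtain ⟨a, ha, x, hx, rfl⟩ := Subgroup.mem_sup_of_normal_right.mp hg₁
  obtain ⟨b, hb, y, hy, hab⟩ := Subgroup.mem_sup_of_normal_right.mp hg₂
  have heq : b⁻¹ * a = y * x⁻¹ := by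
    rw [inv_mul_eq_iff_eq_mul, ← mul_assoc, eq_mul_inv_iff_mul_eq, hab]
  have hmem : y * x⁻¹ ∈ H ⊓ K :=
    ⟨heq ▸ H.mul_mem (H.inv_mem hb) ha, K.mul_mem (h₂ hy) (K.inv_mem (h₁ hx))⟩
  rw [hHK, Subgroup.mem_bot, mul_inv_eq_one] at hmem
  have hx1 : x ∈ L₁ ⊓ L₂ := ⟨hx, hmem ▸ hy⟩
  rw [hL, Subgroup.mem_bot] at hx1
  simpa [hx1] using ha

theorem stmt_10 {G : Type*} [Group G] [Finite G] (p : ℕ) (hp : p.Prime) (hodd : Odd p)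
    (hpG : IsPGroup p G) (H K : Subgroup G)
    (hH : Nat.card H = p) (hHn : ¬ H.Normal)
    (hKn : K.Normal) (hHK : H ⊓ K = ⊥) (hprod : ∀ g : G, ∃ h ∈ H, ∃ k ∈ K, g = h * k)
    (hsub : ∀ L : Subgroup G, L ≤ K → Nat.card L = p → L.Normal)
    (hquot : ∀ (L : Subgroup G) [L.Normal], Nat.card L = p → Nonempty (K ≃* G ⧸ L)) :
    IsCyclic K := by
  have := Fact.mk hp
  by_cases hK : K = ⊥
  · subst hK
    infer_instance
  -- the order of the image of `H` in `G ⧸ L`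
  have hcard (L : Subgroup G) [L.Normal] (hLK : L ≤ K) :
      Nat.card (H.map (QuotientGroup.mk' L)) = p := by
    rw [Subgroup.card_map_of_inf_ker_eq_bot, hH]
    rw [QuotientGroup.ker_mk', ← le_bot_iff, ← hHK]
    exact inf_le_inf_left H hLK
  -- every subgroup of order `p` of `G ⧸ L ≃* K` is normal
  have hnormal (L : Subgroup G) (hLK : L ≤ K) (hL : Nat.card L = p) : (H ⊔ L).Normal := by
    have := hsub L hLK hL
    obtain ⟨e⟩ := hquot L hL
    set A := H.map (QuotientGroup.mk' L) with hA
    have hAn : (((A.map e.symm.toMonoidHom).map K.subtype)).Normal := by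
      refine hsub _ (Subgroup.map_subtype_le _) ?_
      rw [Subgroup.card_map_of_injective K.subtype_injective,
        Subgroup.card_map_of_injective e.symm.injective, hcard L hLK]
    have hAe : A = (((A.map e.symm.toMonoidHom).map K.subtype).comap K.subtype).map
        e.toMonoidHom := by
      rw [Subgroup.comap_map_eq_self_of_injective K.subtype_injective, Subgroup.map_map]
      convert A.map_id.symm
      ext x
      simp
    have hA' : A.Normal := by
      rw [hAe]
      exact (hAn.comap K.subtype).map _ e.surjective
    have hcomap := hA'.comap (QuotientGroup.mk' L)
    rwa [hA, Subgroup.comap_map_eq, QuotientGroup.ker_mk'] at hcomap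
  have hunique (L₁ L₂ : Subgroup G) (h₁ : L₁ ≤ K) (h₂ : L₂ ≤ K) (hc₁ : Nat.card L₁ = p)
      (hc₂ : Nat.card L₂ = p) : L₁ = L₂ := by
    by_contra hne
    have := hsub L₁ h₁ hc₁
    have := hsub L₂ h₂ hc₂
    have := hnormal L₁ h₁ hc₁
    have := hnormal L₂ h₂ hc₂
    refine hHn ?_
    rw [← Subgroup.sup_inf_sup_eq_of_inf_eq_bot h₁ h₂ hHK]
    · infer_instance
    by_contra hbot
    obtain ⟨M, hM, hMc⟩ := hpG.exists_le_card_eq hp hbot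
    exact hne ((Subgroup.eq_of_le_of_card_ge (hM.trans inf_le_left) (hc₁.trans hMc.symm).le).symm.trans
      (Subgroup.eq_of_le_of_card_ge (hM.trans inf_le_right) (hc₂.trans hMc.symm).le))
  obtain ⟨L, hLK, hL⟩ := hpG.exists_le_card_eq hp hK
  have hLn := hsub L hLK hL
  -- `L` is all of `K`: otherwise `K ⧸ L` contains the image of `H`, so `H ≤ K`
  have hKL : K ≤ L := by
    by_contra hnot
    have hbot : K.map (QuotientGroup.mk' L) ≠ ⊥ := by
      rwa [Ne, Subgroup.map_eq_bot_iff, QuotientGroup.ker_mk']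
    obtain ⟨M, hM, hMc⟩ := (hpG.to_quotient L).exists_le_card_eq hp hbot
    obtain ⟨e⟩ := hquot L hL
    have hmap := hunique ((M.map e.symm.toMonoidHom).map K.subtype)
      (((H.map (QuotientGroup.mk' L)).map e.symm.toMonoidHom).map K.subtype)
      (Subgroup.map_subtype_le _) (Subgroup.map_subtype_le _)
      (by rw [Subgroup.card_map_of_injective K.subtype_injective,
        Subgroup.card_map_of_injective e.symm.injective, hMc])
      (by rw [Subgroup.card_map_of_injective K.subtype_injective,
        Subgroup.card_map_of_injective e.symm.injective, hcard L hLK])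
    have hMH := Subgroup.map_injective e.symm.injective
      (Subgroup.map_injective K.subtype_injective hmap)
    rw [hMH, Subgroup.map_le_iff_le_comap, Subgroup.comap_map_eq, QuotientGroup.ker_mk',
      sup_eq_left.mpr hLK] at hM
    have hHbot : H = ⊥ := by rw [← hHK, inf_eq_left.mpr hM]
    rw [hHbot, Subgroup.card_bot] at hH
    exact hp.one_lt.ne hH
  rw [le_antisymm hKL hLK]
  exact isCyclic_of_prime_card hL
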